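/- Let M be a 2×2 integer matrix with determinant 1 and |trace M| > 2, let L : ℝ² → ℝ² be the induced invertible linear map, and let F : ℝ² → ℝ² be a bijection. Suppose P : ℝ² → ℝ² and P' : ℝ² → ℝ² satisfy P ∘ F = L ∘ P and P' ∘ F = L ∘ P', and that sup_{x ∈ ℝ²} ‖P(x) − x‖ < ∞ and sup_{x ∈ ℝ²} ‖P'(x) − x‖ < ∞. Then P = P'. -/

import Mathlib

/-- Cayley–Hamilton for a `2 × 2` matrix of determinant one, applied to a vector. -/
theorem Matrix.mulVec_mulVec_add_self_of_det_eq_one {R : Type*} [CommRing R]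
    (A : Matrix (Fin 2) (Fin 2) R) (hdet : A.det = 1) (v : Fin 2 → R) :
    A.mulVec (A.mulVec v) + v = A.trace • A.mulVec v := by
  rw [Matrix.det_fin_two] at hdet
  ext i
  fin_cases i
  · simp [Matrix.trace_fin_two]
    linear_combination -(v 0) * hdet
  · simp [Matrix.trace_fin_two]
    linear_combination -(v 1) * hdet

/-- A bounded solution of `D (F (F x)) + D x = t • D (F x)` with `F` surjective and `2 < |t|`
vanishes identically. -/
theorem eq_zero_of_bounded_of_recurrence {X E : Type*} [NormedAddCommGroup E] [NormedSpace ℝ E]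
    {F : X → X} (hF : Function.Surjective F) {t : ℝ} (ht : 2 < |t|) {D : X → E} {K : ℝ}
    (hK : ∀ x, ‖D x‖ ≤ K) (hrec : ∀ x, D (F (F x)) + D x = t • D (F x)) (x : X) : D x = 0 := by
  have : Nonempty X := ⟨x⟩
  have hbdd : BddAbove (Set.range fun y => ‖D y‖) := ⟨K, by rintro _ ⟨y, rfl⟩; exact hK y⟩
  set S := ⨆ y, ‖D y‖
  have hle : ∀ y, ‖D y‖ ≤ S := le_ciSup hbdd
  have hmul : ∀ y, |t| * ‖D y‖ ≤ 2 * S := by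
    intro y
    obtain ⟨z, rfl⟩ := hF y
    rw [← Real.norm_eq_abs, ← norm_smul, ← hrec z]
    linarith [norm_add_le (D (F (F z))) (D z), hle (F (F z)), hle z]
  have hS : S ≤ 2 * S / |t| :=
    ciSup_le fun y => (le_div_iff₀' (by linarith)).2 (hmul y)
  rw [le_div_iff₀ (by linarith)] at hS
  have hS0 : S ≤ 0 := by nlinarith
  exact norm_le_zero_iff.1 ((hle x).trans hS0)


/-- Uniqueness of the bounded-distance semiconjugacy to a hyperbolic linear map. -/
theorem semiconjugacy_unique (M : Matrix (Fin 2) (Fin 2) ℤ)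
    (hdet : M.det = 1) (htr : |M.trace| > 2)
    (L : (Fin 2 → ℝ) →ₗ[ℝ] (Fin 2 → ℝ))
    (hL : L = Matrix.toLin' (M.map ((↑) : ℤ → ℝ)))
    (F : (Fin 2 → ℝ) → (Fin 2 → ℝ)) (hFbij : Function.Bijective F)
    (P P' : (Fin 2 → ℝ) → (Fin 2 → ℝ))
    (hP : P ∘ F = ⇑L ∘ P) (hP' : P' ∘ F = ⇑L ∘ P')
    (C : ℝ) (hPb : ∀ x, ‖P x - x‖ ≤ C)
    (C' : ℝ) (hP'b : ∀ x, ‖P' x - x‖ ≤ C') :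
    P = P' := by
  have hdetR : (M.map ((↑) : ℤ → ℝ)).det = 1 := by
    simpa [hdet] using ((Int.castRingHom ℝ).map_det M).symm
  have htrR : 2 < |(M.map ((↑) : ℤ → ℝ)).trace| := by
    have h : (M.map ((↑) : ℤ → ℝ)).trace = (M.trace : ℝ) := by
      simp [Matrix.trace_fin_two]
    rw [h]
    exact_mod_cast htr
  have hPF : ∀ x, P (F x) = L (P x) := congrFun hP
  have hPF' : ∀ x, P' (F x) = L (P' x) := congrFun hP'
  have hD : ∀ x, P (F x) - P' (F x) = (M.map ((↑) : ℤ → ℝ)).mulVec (P x - P' x) := by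
    intro x
    rw [hPF, hPF', ← map_sub, hL, Matrix.toLin'_apply]
  have hbound : ∀ x, ‖P x - P' x‖ ≤ C + C' := by
    intro x
    rw [← sub_sub_sub_cancel_right (P x) (P' x) x]
    exact (norm_sub_le _ _).trans (add_le_add (hPb x) (hP'b x))
  funext x
  refine sub_eq_zero.1 (eq_zero_of_bounded_of_recurrence (D := fun x => P x - P' x)
    hFbij.surjective htrR hbound (fun y => ?_) x)
  simp only [hD]
  exact Matrix.mulVec_mulVec_add_self_of_det_eq_one _ hdetR _
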